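/- Let W be a symmetric and singular discrete memoryless channel and ε ∈ (0,1) with V_ε(W) > 0. Then there exists a constant K(ε,W) > 0 such that for every blocklength N ∈ ℤ⁺, ln M*_fb(N,ε) ≤ N·C(W) + √(N·V_ε(W))·Φ^{−1}(ε) + K(ε,W), where M*_fb(N,ε) is the maximum number of messages achievable at blocklength N with average error probability at most ε by codes with ideal feedback. -/

import Mathlib

open Real Finset

variable {X Y : Type} [Fintype X] [Fintype Y]

/-- A discrete memoryless channel: `W x y` is the probability of output `y` given input `x`. -/
def IsDMC (W : X → Y → ℝ) : Prop :=
  (∀ x y, 0 ≤ W x y) ∧ ∀ x, ∑ y, W x y = 1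

/-- A probability distribution on a finite alphabet. -/
def IsProbDist (Q : X → ℝ) : Prop :=
  (∀ x, 0 ≤ Q x) ∧ ∑ x, Q x = 1

/-- Gallager symmetry: the output alphabet can be partitioned into classes such that within
each class every row is a permutation of every other row, and every column is a permutation
of every other column. -/
def GallagerSymmetric (W : X → Y → ℝ) : Prop :=
  ∃ cls : Y → ℕ,
    (∀ (l : ℕ) (x x' : X),
        ((Finset.univ.filter fun y => cls y = l).val.map fun y => W x y) =
        ((Finset.univ.filter fun y => cls y = l).val.map fun y => W x' y)) ∧
    (∀ y y' : Y, cls y = cls y' →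
        (Finset.univ.val.map fun x => W x y) = (Finset.univ.val.map fun x => W x y'))

/-- Singularity: whenever two inputs both give an output positive probability,
they give it the same probability. -/
def Singular (W : X → Y → ℝ) : Prop :=
  ∀ x z y, 0 < W x y * W z y → W x y = W z y

/-- Gallager's function `E_o(ρ, Q)`. -/
noncomputable def Eo (W : X → Y → ℝ) (Q : X → ℝ) (ρ : ℝ) : ℝ :=
  - Real.log (∑ y, (∑ x, Q x * W x y ^ (1 / (1 + ρ))) ^ (1 + ρ))

/-- Mutual information `I(Q; W)`. -/
noncomputable def mutualInfo (W : X → Y → ℝ) (Q : X → ℝ) : ℝ :=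
  ∑ x, ∑ y, Q x * W x y * Real.log (W x y / ∑ z, Q z * W z y)

/-- Channel capacity `C(W)`. -/
noncomputable def capacity (W : X → Y → ℝ) : ℝ :=
  sSup {r | ∃ Q, IsProbDist Q ∧ r = mutualInfo W Q}

/-- The set of values whose supremum is the sphere-packing exponent. -/
def ESPset (W : X → Y → ℝ) (R : ℝ) : Set ℝ :=
  {e | ∃ Q, IsProbDist Q ∧ ∃ ρ : ℝ, 0 ≤ ρ ∧ e = Eo W Q ρ - ρ * R}

/-- The sphere-packing exponent `E_SP(R) = max_Q sup_{ρ ≥ 0} (E_o(ρ,Q) - ρ R)`. -/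
noncomputable def ESP (W : X → Y → ℝ) (R : ℝ) : ℝ := sSup (ESPset W R)

/-- The random coding exponent `E_r(R) = max_Q max_{0 ≤ ρ ≤ 1} (E_o(ρ,Q) - ρ R)`. -/
noncomputable def Er (W : X → Y → ℝ) (R : ℝ) : ℝ :=
  sSup {e | ∃ Q, IsProbDist Q ∧ ∃ ρ : ℝ, 0 ≤ ρ ∧ ρ ≤ 1 ∧ e = Eo W Q ρ - ρ * R}

/-- `R_∞`: the supremum of rates at which the sphere-packing exponent is infinite
(i.e. the defining supremum is unbounded). -/
noncomputable def Rinf (W : X → Y → ℝ) : ℝ :=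
  sSup {R | ¬ BddAbove (ESPset W R)}

/-- The critical rate `R_cr`: the smallest rate above which `E_r = E_SP`. -/
noncomputable def Rcr (W : X → Y → ℝ) : ℝ :=
  sInf {R | ∀ R', R ≤ R' → Er W R' = ESP W R'}

/-- Number of messages of an `(N, R)` code: `⌈e^{NR}⌉`. -/
noncomputable def Mof (N : ℕ) (R : ℝ) : ℕ := ⌈Real.exp (N * R)⌉₊

/-- Error probability of message `m` for a (non-feedback) block code. -/
noncomputable def msgErrorProb (W : X → Y → ℝ) {N M : ℕ}
    (f : Fin M → Fin N → X) (φ : (Fin N → Y) → Fin M) (m : Fin M) : ℝ :=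
  ∑ y ∈ Finset.univ.filter (fun y : Fin N → Y => φ y ≠ m), ∏ n, W (f m n) (y n)

/-- Average error probability of a (non-feedback) block code. -/
noncomputable def avgErrorProb (W : X → Y → ℝ) {N M : ℕ}
    (f : Fin M → Fin N → X) (φ : (Fin N → Y) → Fin M) : ℝ :=
  (M : ℝ)⁻¹ * ∑ m, msgErrorProb W f φ m

/-- A feedback encoder, given as a function of the whole output word, is causal if the symbol
sent at time `n` depends only on the message and the outputs at times `< n`. -/
def Causal {N M : ℕ} (f : Fin M → (Fin N → Y) → Fin N → X) : Prop :=
  ∀ m y y' n, (∀ k, k < n → y k = y' k) → f m y n = f m y' n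

/-- Average error probability of a feedback code. -/
noncomputable def avgErrorProbFb (W : X → Y → ℝ) {N M : ℕ}
    (f : Fin M → (Fin N → Y) → Fin N → X) (φ : (Fin N → Y) → Fin M) : ℝ :=
  (M : ℝ)⁻¹ * ∑ m, ∑ y ∈ Finset.univ.filter (fun y : Fin N → Y => φ y ≠ m),
      ∏ n, W (f m y n) (y n)

/-- The (conditional information) dispersion `V(Q, W)`. -/
noncomputable def Vdisp (W : X → Y → ℝ) (Q : X → ℝ) : ℝ :=
  ∑ x, ∑ y, Q x * W x y *
    (Real.log (W x y / ∑ z, Q z * W z y) -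
      ∑ b, W x b * Real.log (W x b / ∑ z, Q z * W z b)) ^ 2

/-- The `ε`-dispersion `V_ε(W)`: the minimum (for `ε < 1/2`) or maximum (for `ε ≥ 1/2`) of
`V(Q,W)` over capacity-achieving input distributions `Q`. -/
noncomputable def Veps (W : X → Y → ℝ) (ε : ℝ) : ℝ :=
  if ε < 1 / 2 then
    sInf {v | ∃ Q, IsProbDist Q ∧ mutualInfo W Q = capacity W ∧ v = Vdisp W Q}
  else
    sSup {v | ∃ Q, IsProbDist Q ∧ mutualInfo W Q = capacity W ∧ v = Vdisp W Q}

/-- The standard Gaussian cumulative distribution function `Φ`. -/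
noncomputable def stdGaussCDF (x : ℝ) : ℝ :=
  (Real.sqrt (2 * Real.pi))⁻¹ * ∫ t in Set.Iic x, Real.exp (-t ^ 2 / 2)

/-- The inverse `Φ⁻¹` of the standard Gaussian CDF. -/
noncomputable def stdGaussInvCDF (p : ℝ) : ℝ := sInf {x | p ≤ stdGaussCDF x}


/-- Mean value theorem, with the increment as an explicit variable. -/
lemma exists_sub_eq_mul_deriv {f f' : ℝ → ℝ} (hf : ∀ x, HasDerivAt f (f' x) x) (s x : ℝ) :
    ∃ θ, |θ| ≤ |x| ∧ f (x + s) - f s = x * f' (s + θ) := by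
  have hc : Continuous f := continuous_iff_continuousAt.2 fun x => (hf x).continuousAt
  rcases lt_trichotomy x 0 with hx | rfl | hx
  · obtain ⟨c, hc, h⟩ := exists_hasDerivAt_eq_slope f f' (show x + s < s by linarith)
      hc.continuousOn fun x _ => hf x
    refine ⟨c - s, ?_, ?_⟩
    · rw [abs_of_neg hx, abs_of_neg (by linarith [hc.2])]
      linarith [hc.1]
    · rw [add_sub_cancel, h, mul_div_assoc', eq_div_iff (by linarith)]
      ring
  · exact ⟨0, by simp⟩
  · obtain ⟨c, hc, h⟩ := exists_hasDerivAt_eq_slope f f' (show s < x + s by linarith)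
      hc.continuousOn fun x _ => hf x
    refine ⟨c - s, ?_, ?_⟩
    · rw [abs_of_pos hx, abs_of_pos (by linarith [hc.1])]
      linarith [hc.2]
    · rw [add_sub_cancel, h, mul_div_assoc', eq_div_iff (by linarith)]
      ring

/-- The expectation of `G (S n)`, where `S n` is the sum of `n` independent copies of a variable
taking the value `T b` with weight `a b`. -/
noncomputable def iidSumExp (a T : Y → ℝ) : ℕ → (ℝ → ℝ) → ℝ
  | 0, G => G 0
  | n + 1, G => ∑ b, a b * iidSumExp a T n fun s => G (T b + s)

namespace iidSumExp

variable {a T : Y → ℝ}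

lemma add (n : ℕ) (G H : ℝ → ℝ) :
    iidSumExp a T n (fun s => G s + H s) = iidSumExp a T n G + iidSumExp a T n H := by
  induction n generalizing G H with
  | zero => rfl
  | succ n ih => simp only [iidSumExp, ih, mul_add, sum_add_distrib]

lemma const_mul (n : ℕ) (c : ℝ) (G : ℝ → ℝ) :
    iidSumExp a T n (fun s => c * G s) = c * iidSumExp a T n G := by
  induction n generalizing G with
  | zero => rfl
  | succ n ih =>
    simp only [iidSumExp, ih, mul_sum]
    exact sum_congr rfl fun b _ => by ring

lemma sum {ι : Type*} (n : ℕ) (t : Finset ι) (G : ι → ℝ → ℝ) :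
    iidSumExp a T n (fun s => ∑ i ∈ t, G i s) = ∑ i ∈ t, iidSumExp a T n (G i) := by
  classical
  induction t using Finset.induction_on with
  | empty => simpa using const_mul (a := a) (T := T) n 0 (fun _ => 0)
  | insert i t hi ih => simp only [sum_insert hi, add, ih]

lemma mono (ha : ∀ b, 0 ≤ a b) (n : ℕ) {G H : ℝ → ℝ} (h : ∀ s, G s ≤ H s) :
    iidSumExp a T n G ≤ iidSumExp a T n H := by
  induction n generalizing G H with
  | zero => exact h 0
  | succ n ih =>
    exact sum_le_sum fun b _ => mul_le_mul_of_nonneg_left (ih fun s => h _) (ha b)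

lemma mono_of_abs_le {B : ℝ} (ha : ∀ b, 0 ≤ a b) (hB : ∀ b, |T b| ≤ B) (n : ℕ)
    {G H : ℝ → ℝ} (h : ∀ s, |s| ≤ n * B → G s ≤ H s) :
    iidSumExp a T n G ≤ iidSumExp a T n H := by
  induction n generalizing G H with
  | zero => exact h 0 (by simp)
  | succ n ih =>
    refine sum_le_sum fun b _ => mul_le_mul_of_nonneg_left (ih fun s hs => h _ ?_) (ha b)
    push_cast
    linarith [abs_add_le (T b) s, hB b]

lemma const (ha : ∑ b, a b = 1) (n : ℕ) (c : ℝ) : iidSumExp a T n (fun _ => c) = c := by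
  induction n with
  | zero => rfl
  | succ n ih => simp only [iidSumExp, ih, ← sum_mul, ha, one_mul]

lemma succ_eq (n : ℕ) (G : ℝ → ℝ) :
    iidSumExp a T (n + 1) G = iidSumExp a T n (fun s => ∑ b, a b * G (T b + s)) := by
  simp only [sum, const_mul]
  rfl

/-- Exchangeability: `E[S g(S)] = n E[X g(S' + X)]` with `S'` one step shorter than `S`. -/
lemma id_mul (n : ℕ) (G : ℝ → ℝ) :
    iidSumExp a T (n + 1) (fun s => s * G s) =
      (n + 1) * iidSumExp a T n (fun s => ∑ b, a b * (T b * G (T b + s))) := by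
  induction n generalizing G with
  | zero => simp [iidSumExp]
  | succ n ih =>
    have h : iidSumExp a T (n + 2) (fun s => s * G s) =
        ∑ b, a b * (T b * iidSumExp a T (n + 1) (fun s => G (T b + s))) +
        ∑ b, a b * iidSumExp a T (n + 1) (fun s => s * G (T b + s)) := by
      rw [← sum_add_distrib]
      refine sum_congr rfl fun b _ => ?_
      rw [← mul_add, ← const_mul (T := T) (n + 1) (T b), ← add]
      simp only [add_mul]
    rw [h]
    have h2 : iidSumExp a T (n + 1) (fun s => ∑ b, a b * (T b * G (T b + s))) =
        ∑ b, a b * (T b * iidSumExp a T (n + 1) (fun s => G (T b + s))) := by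
      simp only [sum, const_mul]
    have h3 : ∑ b, a b * iidSumExp a T (n + 1) (fun s => s * G (T b + s)) =
        (n + 1) * iidSumExp a T (n + 1) (fun s => ∑ b, a b * (T b * G (T b + s))) := by
      rw [show iidSumExp a T (n + 1) (fun s => ∑ b, a b * (T b * G (T b + s))) =
        ∑ c, a c * iidSumExp a T n (fun s => ∑ b, a b * (T b * G (T b + (T c + s)))) from rfl,
        mul_sum]
      refine sum_congr rfl fun c _ => ?_
      rw [ih]
      simp only [add_left_comm (T c)]
      ring
    rw [h3, h2]
    push_cast
    ring

/-- Exponential change of measure. -/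
lemma exp_tilt (c : ℝ) (n : ℕ) (G : ℝ → ℝ) :
    iidSumExp (fun b => a b * exp (T b + c)) T n G =
      iidSumExp a T n (fun s => exp (s + n * c) * G s) := by
  induction n generalizing G with
  | zero => simp [iidSumExp]
  | succ n ih =>
    simp only [iidSumExp, ih]
    refine sum_congr rfl fun b _ => ?_
    rw [mul_assoc, ← const_mul]
    congr 2
    ext s
    rw [← mul_assoc, ← exp_add]
    push_cast
    ring_nf

section Moments

variable (ha : ∀ b, 0 ≤ a b) (ha1 : ∑ b, a b = 1) (hT : ∑ b, a b * T b = 0)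
  {V : ℝ} (hV : ∑ b, a b * T b ^ 2 = V)

include ha1 hT hV in
lemma sq (n : ℕ) : iidSumExp a T n (fun s => s * s) = n * V := by
  cases n with
  | zero => simp [iidSumExp]
  | succ n =>
    have : ∀ s, ∑ b, a b * (T b * (T b + s)) = V := fun s => by
      have : ∀ b, a b * (T b * (T b + s)) = a b * T b ^ 2 + a b * T b * s := fun b => by ring
      simp only [this, sum_add_distrib, ← sum_mul, hT, hV, zero_mul, add_zero]
    rw [id_mul n fun s => s]
    simp only [this, const ha1]
    push_cast
    ring

include ha ha1 hT hV in
lemma abs_le_of_sq_le (n : ℕ) {r : ℝ} (hr : 0 < r) (h : n * V ≤ r ^ 2) :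
    iidSumExp a T n (fun s => |s|) ≤ r := by
  have h1 : iidSumExp a T n (fun s => |s|) ≤
      iidSumExp a T n (fun s => (2 * r)⁻¹ * (s * s) + r / 2) := by
    refine mono ha n fun s => ?_
    have : (2 * r)⁻¹ * (s * s) + r / 2 - |s| = (2 * r)⁻¹ * (|s| - r) ^ 2 := by
      rw [← abs_mul_abs_self s]
      field_simp
      ring
    have : 0 ≤ (2 * r)⁻¹ * (|s| - r) ^ 2 := by positivity
    linarith
  rw [add n (fun s => (2 * r)⁻¹ * (s * s)) (fun _ => r / 2), const ha1, const_mul,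
    sq ha1 hT hV] at h1
  have : (2 * r)⁻¹ * (n * V) ≤ (2 * r)⁻¹ * r ^ 2 := by gcongr
  have h3 : (2 * r)⁻¹ * r ^ 2 = r / 2 := by field_simp
  linarith

include ha ha1 hT hV in
/-- A concentration inequality: the sum lies near any given point `l` with probability of
order `1 / √n`. -/
lemma concentration {B : ℝ} (hB : ∀ b, |T b| ≤ B) (n : ℕ) {r : ℝ} (hr : 0 < r)
    (hr2 : (n + 1) * V = r ^ 2) (l : ℝ) :
    iidSumExp a T n (fun s => (1 + (s - l) ^ 2)⁻¹) ≤ 4 * (1 + B ^ 2) / r := by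
  have hup : iidSumExp a T (n + 1) (fun s => s * arctan (s - l)) ≤ 2 * r := by
    calc _ ≤ iidSumExp a T (n + 1) (fun s => 2 * |s|) := by
          refine mono ha _ fun s => ?_
          refine (le_abs_self _).trans ?_
          rw [abs_mul, mul_comm]
          have : |arctan (s - l)| ≤ 2 := by
            rw [abs_le]
            constructor <;>
            linarith [neg_pi_div_two_lt_arctan (s - l), arctan_lt_pi_div_two (s - l), pi_le_four]
          gcongr
      _ ≤ 2 * r := by
          rw [const_mul]
          gcongr
          exact abs_le_of_sq_le ha ha1 hT hV _ hr (by push_cast; exact hr2.le)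
  have hstep : ∀ s x : ℝ, |x| ≤ B →
      x ^ 2 * ((2 * (1 + B ^ 2))⁻¹ * (1 + s ^ 2)⁻¹) ≤ x * (arctan (x + s) - arctan s) := by
    intro s x hx
    obtain ⟨θ, hθ, h⟩ : ∃ θ : ℝ, |θ| ≤ B ∧
        arctan (x + s) - arctan s = x * (1 + (s + θ) ^ 2)⁻¹ := by
      obtain ⟨θ, hθ, h⟩ := exists_sub_eq_mul_deriv hasDerivAt_arctan' s x
      exact ⟨θ, hθ.trans hx, h⟩
    rw [h]
    have h1 : (1 + (s + θ) ^ 2) ≤ 2 * (1 + B ^ 2) * (1 + s ^ 2) := by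
      have : θ ^ 2 ≤ B ^ 2 := sq_le_sq' (by linarith [abs_le.1 hθ]) (abs_le.1 hθ).2
      nlinarith [sq_nonneg (s - θ), mul_nonneg (sq_nonneg B) (sq_nonneg s)]
    rw [← mul_inv, ← mul_assoc, ← pow_two]
    gcongr
  have hlow : (n + 1) * (V * ((2 * (1 + B ^ 2))⁻¹ *
      iidSumExp a T n (fun s => (1 + (s - l) ^ 2)⁻¹))) ≤
      iidSumExp a T (n + 1) (fun s => s * arctan (s - l)) := by
    rw [id_mul n fun s => arctan (s - l), ← const_mul, ← const_mul]
    refine mul_le_mul_of_nonneg_left (mono ha n fun s => ?_) (by positivity)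
    have : ∑ b, a b * (T b * arctan (T b + s - l)) =
        ∑ b, a b * (T b * (arctan (T b + (s - l)) - arctan (s - l))) := by
      have h : ∀ b, a b * (T b * (arctan (T b + (s - l)) - arctan (s - l))) =
        a b * (T b * arctan (T b + s - l)) - a b * T b * arctan (s - l) := fun b => by
        rw [add_sub_assoc]; ring
      simp only [h, sum_sub_distrib, ← sum_mul, hT, zero_mul, sub_zero]
    rw [this, ← hV, sum_mul]
    refine sum_le_sum fun b _ => ?_
    rw [mul_assoc]
    exact mul_le_mul_of_nonneg_left (hstep _ _ (hB b)) (ha b)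
  rw [← mul_assoc, hr2] at hlow
  have h := hlow.trans hup
  rw [le_div_iff₀ hr]
  have hB2 : 0 < 1 + B ^ 2 := by positivity
  generalize iidSumExp a T n (fun s => (1 + (s - l) ^ 2)⁻¹) = E at h ⊢
  have h5 : r ^ 2 * ((2 * (1 + B ^ 2))⁻¹ * E) = (E * r) * r / (2 * (1 + B ^ 2)) := by
    field_simp
  rw [h5, div_le_iff₀ (by positivity)] at h
  have : (E * r) * r ≤ (4 * (1 + B ^ 2)) * r := by linarith
  exact le_of_mul_le_mul_right this hr

end Moments

end iidSumExp

open MeasureTheory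

lemma integrable_exp_neg_sq_div_two : Integrable fun t : ℝ => exp (-t ^ 2 / 2) := by
  refine (integrable_exp_neg_mul_sq (b := 1 / 2) (by norm_num)).congr (.of_forall fun t => ?_)
  simp only
  ring_nf

lemma integral_exp_neg_sq_div_two : ∫ t : ℝ, exp (-t ^ 2 / 2) = √(2 * π) := by
  have h := integral_gaussian (1 / 2)
  rw [show π / (1 / 2) = 2 * π by ring] at h
  rw [← h]
  congr 1
  ext t
  ring_nf

lemma hasDerivAt_exp_neg_sq_div_two (t : ℝ) :
    HasDerivAt (fun t : ℝ => exp (-t ^ 2 / 2)) (-t * exp (-t ^ 2 / 2)) t := by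
  have h : HasDerivAt (fun t : ℝ => -t ^ 2 / 2) (-t) t := by
    convert! ((hasDerivAt_pow 2 t).neg.div_const 2) using 1
    simp
    ring
  convert! h.exp using 1
  ring

lemma hasDerivAt_exp_sq_div_two (t : ℝ) :
    HasDerivAt (fun t : ℝ => exp (t ^ 2 / 2)) (t * exp (t ^ 2 / 2)) t := by
  have h : HasDerivAt (fun t : ℝ => t ^ 2 / 2) t t := by
    convert! ((hasDerivAt_pow 2 t).div_const 2) using 1
    simp
  convert! h.exp using 1
  ring

lemma integral_Ioi_mul_exp_neg_sq_div_two (w : ℝ) :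
    IntegrableOn (fun t => t * exp (-t ^ 2 / 2)) (Set.Ioi w) ∧
    ∫ t in Set.Ioi w, t * exp (-t ^ 2 / 2) = exp (-w ^ 2 / 2) := by
  have hi : Integrable fun t : ℝ => t * exp (-t ^ 2 / 2) := by
    refine (integrable_mul_exp_neg_mul_sq (b := 1 / 2) (by norm_num)).congr
      (.of_forall fun t => ?_)
    simp only
    ring_nf
  refine ⟨hi.integrableOn, ?_⟩
  have hd : ∀ t : ℝ, HasDerivAt (fun t : ℝ => -exp (-t ^ 2 / 2)) (t * exp (-t ^ 2 / 2)) t :=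
    fun t => by
      convert! (hasDerivAt_exp_neg_sq_div_two t).neg using 1
      ring
  have ht : Filter.Tendsto (fun t : ℝ => -exp (-t ^ 2 / 2)) Filter.atTop (nhds 0) := by
    rw [← neg_zero]
    refine (tendsto_exp_atBot.comp ?_).neg
    refine Filter.Tendsto.atBot_div_const (by norm_num) ?_
    exact Filter.tendsto_neg_atTop_atBot.comp (Filter.tendsto_pow_atTop (by norm_num))
  rw [integral_Ioi_of_hasDerivAt_of_tendsto' (fun t _ => hd t) hi.integrableOn ht]
  ring

/-- Mills' bound on the Gaussian tail. -/
lemma mul_integral_Ioi_exp_neg_sq_div_two_le {w : ℝ} :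
    w * ∫ t in Set.Ioi w, exp (-t ^ 2 / 2) ≤ exp (-w ^ 2 / 2) := by
  obtain ⟨hi, h⟩ := integral_Ioi_mul_exp_neg_sq_div_two w
  rw [← h, ← integral_const_mul]
  refine setIntegral_mono_on (integrable_exp_neg_sq_div_two.integrableOn.const_mul w) hi
    measurableSet_Ioi fun t ht => ?_
  exact mul_le_mul_of_nonneg_right (Set.mem_Ioi.1 ht).le (exp_pos _).le

lemma integral_Iic_exp_neg_sq_div_two (w : ℝ) :
    ∫ t in Set.Iic w, exp (-t ^ 2 / 2) = ∫ t in Set.Ioi (-w), exp (-t ^ 2 / 2) := by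
  rw [← integral_comp_neg_Iic]
  simp

/-- The solution of Stein's equation `f' - w f = h - m`. -/
noncomputable def steinSol (h : ℝ → ℝ) (m w : ℝ) : ℝ :=
  exp (w ^ 2 / 2) * ∫ t in Set.Iic w, (h t - m) * exp (-t ^ 2 / 2)

section Stein

variable {h : ℝ → ℝ} {m : ℝ} (hc : Continuous h)

include hc in
lemma integrable_sub_mul_exp_neg_sq_div_two (h1 : ∀ t, |h t - m| ≤ 1) :
    Integrable fun t => (h t - m) * exp (-t ^ 2 / 2) := by
  refine integrable_exp_neg_sq_div_two.mono'
    (by fun_prop) (.of_forall fun t => ?_)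
  rw [norm_mul, norm_of_nonneg (exp_pos _).le]
  exact mul_le_of_le_one_left (exp_pos _).le (h1 t)

include hc in
lemma hasDerivAt_steinSol (h1 : ∀ t, |h t - m| ≤ 1) (w : ℝ) :
    HasDerivAt (steinSol h m) (w * steinSol h m w + h w - m) w := by
  have hi := integrable_sub_mul_exp_neg_sq_div_two hc h1
  have hcont : Continuous fun t => (h t - m) * exp (-t ^ 2 / 2) := by fun_prop
  have hF : HasDerivAt (fun w => ∫ t in Set.Iic w, (h t - m) * exp (-t ^ 2 / 2))
      ((h w - m) * exp (-w ^ 2 / 2)) w := by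
    have h0 := intervalIntegral.integral_hasDerivAt_right (a := 0) (b := w)
      (hi.intervalIntegrable) (hcont.stronglyMeasurableAtFilter _ _) hcont.continuousAt
    convert! h0.const_add (∫ t in Set.Iic 0, (h t - m) * exp (-t ^ 2 / 2)) using 1
    ext x
    rw [← intervalIntegral.integral_Iic_sub_Iic hi.integrableOn hi.integrableOn]
    ring
  convert! (hasDerivAt_exp_sq_div_two w).mul hF using 1
  have : exp (w ^ 2 / 2) * exp (-w ^ 2 / 2) = 1 := by rw [← exp_add]; ring_nf; simp
  rw [steinSol]
  linear_combination -(h w - m) * this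

variable (hm : ∫ t, (h t - m) * exp (-t ^ 2 / 2) = 0)

include hc hm in
lemma abs_mul_steinSol_le (h1 : ∀ t, |h t - m| ≤ 1) (w : ℝ) :
    |w * steinSol h m w| ≤ 1 := by
  have hi := integrable_sub_mul_exp_neg_sq_div_two hc h1
  have hbd : ∀ s : Set ℝ, |∫ t in s, (h t - m) * exp (-t ^ 2 / 2)| ≤
      ∫ t in s, exp (-t ^ 2 / 2) := fun s => by
    rw [← norm_eq_abs]
    refine norm_integral_le_of_norm_le integrable_exp_neg_sq_div_two.integrableOn
      (.of_forall fun t => ?_)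
    rw [norm_mul, norm_of_nonneg (exp_pos _).le]
    exact mul_le_of_le_one_left (exp_pos _).le (h1 t)
  have hexp : exp (w ^ 2 / 2) * exp (-w ^ 2 / 2) = 1 := by rw [← exp_add]; ring_nf; simp
  have key : |w| * |∫ t in Set.Iic w, (h t - m) * exp (-t ^ 2 / 2)| ≤ exp (-w ^ 2 / 2) := by
    rcases le_total 0 w with hw | hw
    · have hs := intervalIntegral.integral_Iic_add_Ioi (b := w) hi.integrableOn hi.integrableOn
      rw [hm] at hs
      rw [eq_neg_of_add_eq_zero_left hs, abs_neg, abs_of_nonneg hw]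
      exact (mul_le_mul_of_nonneg_left (hbd _) hw).trans mul_integral_Ioi_exp_neg_sq_div_two_le
    · rw [abs_of_nonpos hw]
      refine (mul_le_mul_of_nonneg_left (hbd _) (by linarith)).trans ?_
      rw [integral_Iic_exp_neg_sq_div_two]
      simpa using mul_integral_Ioi_exp_neg_sq_div_two_le (w := -w)
  rw [abs_mul, steinSol, abs_mul, abs_of_pos (exp_pos _), mul_left_comm, ← hexp]
  exact mul_le_mul_of_nonneg_left key (exp_pos _).le

include hc hm in
lemma abs_steinSol_le (h1 : ∀ t, |h t - m| ≤ 1) (w : ℝ) :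
    |steinSol h m w| ≤ exp 1 * √(2 * π) + 1 := by
  rcases le_total 1 |w| with hw | hw
  · have := abs_mul_steinSol_le hc hm h1 w
    rw [abs_mul] at this
    have : |steinSol h m w| ≤ 1 := by nlinarith [abs_nonneg (steinSol h m w)]
    have : 0 ≤ exp 1 * √(2 * π) := by positivity
    linarith
  · have h2 : w ^ 2 / 2 ≤ 1 := by
      have : w ^ 2 ≤ 1 := (sq_le_one_iff_abs_le_one w).2 hw
      linarith
    have h3 : |∫ t in Set.Iic w, (h t - m) * exp (-t ^ 2 / 2)| ≤ √(2 * π) := by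
      rw [← integral_exp_neg_sq_div_two, ← norm_eq_abs]
      refine (norm_integral_le_of_norm_le (g := fun t => exp (-t ^ 2 / 2))
        integrable_exp_neg_sq_div_two.integrableOn (.of_forall fun t => ?_)).trans
        (setIntegral_le_integral integrable_exp_neg_sq_div_two
          (.of_forall fun t => (exp_pos _).le))
      rw [norm_mul, norm_of_nonneg (exp_pos _).le]
      exact mul_le_of_le_one_left (exp_pos _).le (h1 t)
    rw [steinSol, abs_mul, abs_of_pos (exp_pos _)]
    have : exp (w ^ 2 / 2) * |∫ t in Set.Iic w, (h t - m) * exp (-t ^ 2 / 2)| ≤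
      exp 1 * √(2 * π) := by gcongr
    linarith

include hc hm in
/-- The map `w ↦ w f(w)`, for the Stein solution `f`, is Lipschitz on bounded sets. -/
lemma abs_mul_steinSol_sub_le (h1 : ∀ t, |h t - m| ≤ 1) {c x y : ℝ}
    (hx : |x| ≤ c) (hy : |y| ≤ c) :
    |x * steinSol h m x - y * steinSol h m y| ≤
      (exp 1 * √(2 * π) + 1 + 2 * c) * |x - y| := by
  rw [← norm_eq_abs, ← norm_eq_abs (x - y)]
  refine (convex_Icc (-c) c).norm_image_sub_le_of_norm_hasDerivWithin_le
    (f := fun w => w * steinSol h m w)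
    (fun w _ => ((hasDerivAt_id w).mul (hasDerivAt_steinSol hc h1 w)).hasDerivWithinAt)
    (fun w hw => ?_) (abs_le.1 hy) (abs_le.1 hx)
  have hw' : |w| ≤ c := abs_le.2 hw
  have h2 : |w * steinSol h m w + (h w - m)| ≤ 2 :=
    (abs_add_le _ _).trans (by linarith [abs_mul_steinSol_le hc hm h1 w, h1 w])
  have h3 : |w * (w * steinSol h m w + (h w - m))| ≤ 2 * c := by
    rw [abs_mul, mul_comm]
    gcongr
  rw [one_mul, id, add_sub_assoc]
  exact (abs_add_le _ _).trans (add_le_add (abs_steinSol_le hc hm h1 w) h3)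

end Stein

/-- The threshold function `s ↦ min(1, e^{s-l})`. -/
noncomputable def softStep (l s : ℝ) : ℝ := min 1 (exp (s - l))

lemma softStep_nonneg (l s : ℝ) : 0 ≤ softStep l s := le_min zero_le_one (exp_pos _).le

lemma softStep_le_one (l s : ℝ) : softStep l s ≤ 1 := min_le_left _ _

lemma continuous_softStep (l : ℝ) : Continuous (softStep l) := by
  unfold softStep
  fun_prop

lemma exp_neg_abs_le (x : ℝ) : exp (-|x|) ≤ 2 * (1 + x ^ 2)⁻¹ := by
  rw [exp_neg, ← div_eq_mul_inv, inv_eq_one_div, div_le_div_iff₀ (exp_pos _) (by positivity)]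
  have := quadratic_le_exp_of_nonneg (abs_nonneg x)
  rw [sq_abs] at this
  linarith [abs_nonneg x]

/-- The threshold function is nearly constant away from the threshold. -/
lemma abs_softStep_sub_le {B l s x y : ℝ} (hx : |x| ≤ B) (hy : |y| ≤ B) :
    |softStep l (x + s) - softStep l (y + s)| ≤ exp B * (2 * (1 + (s - l) ^ 2)⁻¹) := by
  wlog hxy : y ≤ x generalizing x y
  · rw [abs_sub_comm]
    exact this hy hx (le_of_not_ge hxy)
  have hmono : softStep l (y + s) ≤ softStep l (x + s) := by
    unfold softStep
    gcongr
  rw [abs_of_nonneg (sub_nonneg.2 hmono)]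
  have hx2 := abs_le.1 hx
  have hy2 := abs_le.1 hy
  refine le_trans ?_ (mul_le_mul_of_nonneg_left (exp_neg_abs_le (s - l)) (exp_pos _).le)
  rw [← exp_add]
  rcases le_total (s - l) 0 with h0 | h0
  · rw [abs_of_nonpos h0]
    have : softStep l (x + s) ≤ exp (B + - -(s - l)) :=
      (min_le_right _ _).trans (exp_le_exp.2 (by linarith))
    linarith [softStep_nonneg l (y + s)]
  · rw [abs_of_nonneg h0]
    rcases le_total (s - l) B with hB | hB
    · have : 1 ≤ exp (B + -(s - l)) := one_le_exp (by linarith)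
      linarith [softStep_nonneg l (y + s), softStep_le_one l (x + s)]
    · have : softStep l (y + s) = 1 := min_eq_left (one_le_exp (by linarith))
      linarith [softStep_le_one l (x + s), exp_pos (B + -(s - l))]

lemma stdGaussCDF_add_integral_Ioi (x : ℝ) :
    (√(2 * π))⁻¹ * ∫ t in Set.Ioi x, exp (-t ^ 2 / 2) = 1 - stdGaussCDF x := by
  have h := intervalIntegral.integral_Iic_add_Ioi (b := x)
    integrable_exp_neg_sq_div_two.integrableOn integrable_exp_neg_sq_div_two.integrableOn
  rw [integral_exp_neg_sq_div_two] at h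
  have hp : √(2 * π) ≠ 0 := by positivity
  rw [stdGaussCDF, eq_sub_iff_add_eq, ← mul_add, add_comm, h, inv_mul_cancel₀ hp]

/-- The Gaussian mean of the threshold function. -/
noncomputable def softStepGaussMean (r l : ℝ) : ℝ :=
  (√(2 * π))⁻¹ * ∫ t, softStep l (r * t) * exp (-t ^ 2 / 2)

section GaussMean

variable {r : ℝ} (hr : 0 < r) (l : ℝ)

lemma integrable_softStep_mul (r l : ℝ) :
    Integrable fun t => softStep l (r * t) * exp (-t ^ 2 / 2) := by
  have := continuous_softStep l
  refine integrable_exp_neg_sq_div_two.mono' (by fun_prop) (.of_forall fun t => ?_)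
  rw [norm_mul, norm_of_nonneg (exp_pos _).le, norm_of_nonneg (softStep_nonneg _ _)]
  exact mul_le_of_le_one_left (exp_pos _).le (softStep_le_one _ _)

lemma softStepGaussMean_nonneg (r l : ℝ) : 0 ≤ softStepGaussMean r l :=
  mul_nonneg (by positivity) (integral_nonneg fun t =>
    mul_nonneg (softStep_nonneg _ _) (exp_pos _).le)

lemma softStepGaussMean_le_one (r l : ℝ) : softStepGaussMean r l ≤ 1 := by
  have h : ∫ t, softStep l (r * t) * exp (-t ^ 2 / 2) ≤ √(2 * π) := by
    rw [← integral_exp_neg_sq_div_two]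
    exact integral_mono (integrable_softStep_mul r l) integrable_exp_neg_sq_div_two
      fun t => mul_le_of_le_one_left (exp_pos _).le (softStep_le_one _ _)
  have hp : 0 < √(2 * π) := by positivity
  rw [softStepGaussMean, inv_mul_eq_div, div_le_one hp]
  exact h

lemma integral_softStep_sub_mean (r l : ℝ) :
    ∫ t, (softStep l (r * t) - softStepGaussMean r l) * exp (-t ^ 2 / 2) = 0 := by
  have hp : √(2 * π) ≠ 0 := by positivity
  simp only [sub_mul]
  rw [integral_sub (integrable_softStep_mul r l)
    (integrable_exp_neg_sq_div_two.const_mul _), integral_const_mul,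
    integral_exp_neg_sq_div_two, softStepGaussMean]
  field_simp
  ring

lemma abs_softStep_sub_mean_le (r l t : ℝ) :
    |softStep l (r * t) - softStepGaussMean r l| ≤ 1 := by
  rw [abs_le]
  constructor <;>
  linarith [softStepGaussMean_nonneg r l, softStepGaussMean_le_one r l,
    softStep_nonneg l (r * t), softStep_le_one l (r * t)]

include hr in
lemma softStepGaussMean_le : softStepGaussMean r l ≤ 1 - stdGaussCDF (l / r) + 1 / r := by
  have hi := integrable_softStep_mul r l
  rw [softStepGaussMean, ← intervalIntegral.integral_Iic_add_Ioi (b := l / r) hi.integrableOn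
    hi.integrableOn, mul_add, ← stdGaussCDF_add_integral_Ioi, add_comm]
  gcongr ?_ + ?_
  · refine mul_le_mul_of_nonneg_left ?_ (by positivity)
    exact setIntegral_mono hi.integrableOn integrable_exp_neg_sq_div_two.integrableOn
      fun t => mul_le_of_le_one_left (exp_pos _).le (softStep_le_one _ _)
  · have hp : (√(2 * π))⁻¹ ≤ 1 := inv_le_one_of_one_le₀ (by
      rw [one_le_sqrt]; linarith [pi_gt_three])
    have h : ∫ t in Set.Iic (l / r), softStep l (r * t) * exp (-t ^ 2 / 2) ≤ 1 / r := by
      calc _ ≤ ∫ t in Set.Iic (l / r), exp (-l) * exp (r * t) := by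
            refine setIntegral_mono hi.integrableOn
              ((integrableOn_exp_mul_Iic hr _).const_mul _) fun t => ?_
            have h1 : exp (-t ^ 2 / 2) ≤ 1 := exp_le_one_iff.2 (by nlinarith [sq_nonneg t])
            refine (mul_le_of_le_one_right (softStep_nonneg _ _) h1).trans ?_
            rw [← exp_add]
            exact (min_le_right _ _).trans (exp_le_exp.2 (by linarith))
        _ = 1 / r := by
            rw [integral_const_mul, integral_exp_mul_Iic hr, mul_div_cancel₀ _ hr.ne',
              mul_div_assoc', ← exp_add]
            simp
    have h0 : 0 ≤ ∫ t in Set.Iic (l / r), softStep l (r * t) * exp (-t ^ 2 / 2) :=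
      integral_nonneg fun t => mul_nonneg (softStep_nonneg _ _) (exp_pos _).le
    exact (mul_le_of_le_one_left h0 hp).trans h

end GaussMean

namespace iidSumExp

variable {a T : Y → ℝ} (ha : ∀ b, 0 ≤ a b) (ha1 : ∑ b, a b = 1) (hT : ∑ b, a b * T b = 0)
  {V : ℝ} (hV : ∑ b, a b * T b ^ 2 = V) (hV0 : 0 < V) {B : ℝ} (hB : ∀ b, |T b| ≤ B)

include ha ha1 hT hV hV0 in
/-- Stein's method: the error of normal approximation as an expectation of small increments. -/
lemma sub_gaussMean_le {f f' : ℝ → ℝ} (hf : ∀ w, HasDerivAt f (f' w) w) {h : ℝ → ℝ} {m : ℝ}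
    (n : ℕ) {r : ℝ} (hr : 0 < r) (hr2 : (n + 1) * V = r ^ 2)
    (hf' : ∀ s, f' (r⁻¹ * s) = r⁻¹ * s * f (r⁻¹ * s) + h s - m)
    {D : ℝ → ℝ} (hD : ∀ b s θ, |θ| ≤ |T b| → ∀ d,
      f' (r⁻¹ * (T d + s)) - f' (r⁻¹ * (θ + s)) ≤ D s) :
    iidSumExp a T (n + 1) h - m ≤ iidSumExp a T n D := by
  have h1 : iidSumExp a T (n + 1) h - m = iidSumExp a T (n + 1) (fun s => f' (r⁻¹ * s)) -
      r⁻¹ * iidSumExp a T (n + 1) (fun s => s * f (r⁻¹ * s)) := by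
    have hh : h = fun s => f' (r⁻¹ * s) + (-r⁻¹ * (s * f (r⁻¹ * s)) + m) := by
      ext s
      rw [hf']
      ring
    conv_lhs => rw [hh]
    rw [add, add (n + 1) (fun s => -r⁻¹ * (s * f (r⁻¹ * s))), const_mul, const ha1]
    ring
  rw [h1, id_mul n fun s => f (r⁻¹ * s), succ_eq, ← const_mul, ← const_mul, sub_eq_add_neg,
    neg_eq_neg_one_mul, ← const_mul, ← add]
  refine mono ha n fun s => ?_
  have hθ : ∀ b, ∃ θ, |θ| ≤ |T b| ∧
      f (r⁻¹ * (T b + s)) - f (r⁻¹ * s) = r⁻¹ * T b * f' (r⁻¹ * (θ + s)) := fun b => by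
    obtain ⟨θ, hθ, h⟩ := exists_sub_eq_mul_deriv hf (r⁻¹ * s) (r⁻¹ * T b)
    refine ⟨r * θ, ?_, ?_⟩
    · rw [abs_mul, abs_of_pos (inv_pos.2 hr)] at hθ
      rw [abs_mul, abs_of_pos hr]
      rwa [← div_eq_inv_mul, le_div_iff₀' hr] at hθ
    · rw [mul_add, h]
      congr 2
      field_simp
      ring
  choose θ hθ1 hθ2 using hθ
  have h3 : ∑ b, a b * (T b * f (r⁻¹ * (T b + s))) =
      r⁻¹ * ∑ b, a b * T b ^ 2 * f' (r⁻¹ * (θ b + s)) := by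
    have : ∑ b, a b * (T b * f (r⁻¹ * (T b + s))) =
        ∑ b, (r⁻¹ * (a b * T b ^ 2 * f' (r⁻¹ * (θ b + s))) + a b * T b * f (r⁻¹ * s)) :=
      sum_congr rfl fun b _ => by linear_combination (a b * T b) * hθ2 b
    rw [this, sum_add_distrib, ← sum_mul, hT, zero_mul, add_zero, mul_sum]
  have h4 : r⁻¹ * ((n + 1) * (r⁻¹ * ∑ b, a b * T b ^ 2 * f' (r⁻¹ * (θ b + s)))) =
      V⁻¹ * ∑ b, a b * T b ^ 2 * f' (r⁻¹ * (θ b + s)) := by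
    have : (n + 1 : ℝ) = r ^ 2 * V⁻¹ := by rw [← hr2]; field_simp
    rw [this]
    field_simp
  rw [h3, h4]
  have h5 : ∑ d, a d * f' (r⁻¹ * (T d + s)) =
      V⁻¹ * ∑ b, a b * T b ^ 2 * ∑ d, a d * f' (r⁻¹ * (T d + s)) := by
    rw [← sum_mul, hV, inv_mul_cancel_left₀ hV0.ne']
  rw [h5, ← neg_eq_neg_one_mul, ← sub_eq_add_neg, ← mul_sub, ← sum_sub_distrib]
  have h6 : D s = V⁻¹ * ∑ b, a b * T b ^ 2 * D s := by
    rw [← sum_mul, hV, inv_mul_cancel_left₀ hV0.ne']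
  rw [h6]
  refine mul_le_mul_of_nonneg_left (sum_le_sum fun b _ => ?_) (inv_pos.2 hV0).le
  rw [← mul_sub]
  refine mul_le_mul_of_nonneg_left ?_ (mul_nonneg (ha b) (sq_nonneg _))
  calc _ = ∑ d, a d * (f' (r⁻¹ * (T d + s)) - f' (r⁻¹ * (θ b + s))) := by
        simp only [mul_sub, sum_sub_distrib, ← sum_mul, ha1, one_mul]
    _ ≤ ∑ d, a d * D s :=
        sum_le_sum fun d _ => mul_le_mul_of_nonneg_left (hD b s _ (hθ1 b) d) (ha d)
    _ = D s := by rw [← sum_mul, ha1, one_mul]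

include ha ha1 hT hV hV0 hB in
/-- A Berry–Esseen type bound for the threshold function. -/
theorem exists_softStep_le : ∃ c : ℝ, 0 < c ∧ ∀ N : ℕ, 0 < N → ∀ l,
    iidSumExp a T N (softStep l) ≤ 1 - stdGaussCDF (l / √(N * V)) + c / √(N * V) := by
  have hB0 : 0 ≤ B := by
    by_contra! hneg
    have : ∀ b, False := fun b => by linarith [abs_nonneg (T b), hB b]
    have : IsEmpty Y := ⟨this⟩
    simp at ha1
  set F := exp 1 * √(2 * π) + 1
  have hF0 : 0 ≤ F := by positivity
  set κ := F + 2 * (1 + B / √V) with hκ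
  refine ⟨1 + 2 * B * κ + exp B * (2 * (4 * (1 + B ^ 2))), by positivity, fun N hN l => ?_⟩
  obtain ⟨n, rfl⟩ := Nat.exists_eq_succ_of_ne_zero hN.ne'
  set r := √((n.succ : ℝ) * V) with hr
  have hr0 : 0 < r := by positivity
  have hr2 : ((n : ℝ) + 1) * V = r ^ 2 := by
    rw [hr, sq_sqrt (by positivity)]; push_cast; rfl
  have hVr : √V ≤ r := sqrt_le_sqrt (by push_cast; nlinarith)
  have hc : Continuous fun t => softStep l (r * t) := (continuous_softStep l).comp (by fun_prop)
  have h1 := abs_softStep_sub_mean_le r l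
  have hm := integral_softStep_sub_mean r l
  have key := sub_gaussMean_le ha ha1 hT hV hV0 (hasDerivAt_steinSol hc h1) (h := softStep l)
    (m := softStepGaussMean r l) n hr0 hr2
    (fun s => by rw [mul_inv_cancel_left₀ hr0.ne'])
    (D := fun s => (F * (2 * B) / r + 4 * B ^ 2 / r ^ 2) + (4 * B / r ^ 2 * |s| +
      exp B * (2 * (1 + (s - l) ^ 2)⁻¹))) (by
    intro b s θ hθ d
    have hθB := hθ.trans (hB b)
    simp only [mul_inv_cancel_left₀ hr0.ne']
    have hcb : ∀ x : ℝ, |x| ≤ B → |r⁻¹ * (x + s)| ≤ r⁻¹ * (B + |s|) := fun x hx => by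
      rw [abs_mul, abs_of_pos (inv_pos.2 hr0)]
      gcongr
      exact (abs_add_le _ _).trans (by gcongr)
    have h2 := (le_abs_self _).trans
      (abs_mul_steinSol_sub_le hc hm h1 (hcb _ (hB d)) (hcb _ hθB))
    have h3 := (le_abs_self _).trans (abs_softStep_sub_le (l := l) (s := s) (hB d) hθB)
    have h4 : |r⁻¹ * (T d + s) - r⁻¹ * (θ + s)| ≤ r⁻¹ * (2 * B) := by
      rw [← mul_sub, abs_mul, abs_of_pos (inv_pos.2 hr0), add_sub_add_right_eq_sub]
      gcongr
      rw [abs_le]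
      constructor <;> linarith [abs_le.1 (hB d), abs_le.1 hθB]
    have h5 : (F + 2 * (r⁻¹ * (B + |s|))) * |r⁻¹ * (T d + s) - r⁻¹ * (θ + s)| ≤
        (F + 2 * (r⁻¹ * (B + |s|))) * (r⁻¹ * (2 * B)) := by gcongr
    have h6 : (F + 2 * (r⁻¹ * (B + |s|))) * (r⁻¹ * (2 * B)) =
        F * (2 * B) / r + 4 * B ^ 2 / r ^ 2 + 4 * B / r ^ 2 * |s| := by
      field_simp
      ring
    linarith)
  rw [add n (fun _ => F * (2 * B) / r + 4 * B ^ 2 / r ^ 2), const ha1,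
    add n (fun s => 4 * B / r ^ 2 * |s|), const_mul, const_mul, const_mul] at key
  have e1 := abs_le_of_sq_le ha ha1 hT hV n hr0 (by nlinarith)
  have e2 := concentration ha ha1 hT hV hB n hr0 hr2 l
  have e3 := softStepGaussMean_le hr0 l
  have e4 : 4 * B / r ^ 2 * iidSumExp a T n (fun s => |s|) ≤ 4 * B / r ^ 2 * r := by gcongr
  have e5 : exp B * (2 * iidSumExp a T n (fun s => (1 + (s - l) ^ 2)⁻¹)) ≤
    exp B * (2 * (4 * (1 + B ^ 2) / r)) := by gcongr
  have e6 : 4 * B ^ 2 / r ^ 2 ≤ 4 * B * (B / √V) / r := by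
    have : 4 * B ^ 2 / r ^ 2 = 4 * B * (B / r) / r := by field_simp
    rw [this]
    gcongr
  have e7 : (1 + 2 * B * κ + exp B * (2 * (4 * (1 + B ^ 2)))) / r =
      1 / r + (F * (2 * B) / r + 4 * B * (B / √V) / r) + 4 * B / r ^ 2 * r +
      exp B * (2 * (4 * (1 + B ^ 2) / r)) := by
    rw [hκ]
    field_simp
    ring
  rw [e7]
  linarith

end iidSumExp

lemma continuous_stdGaussCDF : Continuous stdGaussCDF := by
  have hi := integrable_exp_neg_sq_div_two
  have h : stdGaussCDF = fun x => (√(2 * π))⁻¹ *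
      ((∫ t in Set.Iic 0, exp (-t ^ 2 / 2)) + ∫ t in (0 : ℝ)..x, exp (-t ^ 2 / 2)) := by
    ext x
    rw [← intervalIntegral.integral_Iic_sub_Iic hi.integrableOn hi.integrableOn, stdGaussCDF]
    ring
  rw [h]
  exact continuous_const.mul (continuous_const.add
    (intervalIntegral.continuous_primitive (fun _ _ => hi.intervalIntegrable) 0))

lemma stdGaussCDF_sub (x y : ℝ) :
    stdGaussCDF y - stdGaussCDF x = (√(2 * π))⁻¹ * ∫ t in x..y, exp (-t ^ 2 / 2) := by
  have hi := integrable_exp_neg_sq_div_two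
  rw [← intervalIntegral.integral_Iic_sub_Iic hi.integrableOn hi.integrableOn, stdGaussCDF,
    stdGaussCDF, mul_sub]

lemma monotone_stdGaussCDF : Monotone stdGaussCDF := fun x y hxy => by
  rw [← sub_nonneg, stdGaussCDF_sub]
  exact mul_nonneg (by positivity)
    (intervalIntegral.integral_nonneg hxy fun t _ => (exp_pos _).le)

lemma one_sub_stdGaussCDF_le {x : ℝ} (hx : 0 < x) : 1 - stdGaussCDF x ≤ 1 / x := by
  have hp : (√(2 * π))⁻¹ ≤ 1 := inv_le_one_of_one_le₀ (by
    rw [one_le_sqrt]; linarith [pi_gt_three])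
  rw [← stdGaussCDF_add_integral_Ioi, le_div_iff₀' hx, mul_left_comm]
  have h := (mul_integral_Ioi_exp_neg_sq_div_two_le (w := x)).trans
    (exp_le_one_iff.2 (by nlinarith [sq_nonneg x]))
  have h0 : 0 ≤ x * ∫ t in Set.Ioi x, exp (-t ^ 2 / 2) :=
    mul_nonneg hx.le (integral_nonneg fun t => (exp_pos _).le)
  exact (mul_le_of_le_one_left h0 hp).trans h

lemma stdGaussCDF_neg (x : ℝ) : stdGaussCDF (-x) = 1 - stdGaussCDF x := by
  rw [← stdGaussCDF_add_integral_Ioi, stdGaussCDF, integral_Iic_exp_neg_sq_div_two, neg_neg]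

lemma le_stdGaussCDF_stdGaussInvCDF {ε : ℝ} (h0 : 0 < ε) (h1 : ε < 1) :
    ε ≤ stdGaussCDF (stdGaussInvCDF ε) := by
  have hclosed : IsClosed {x | ε ≤ stdGaussCDF x} :=
    isClosed_le continuous_const continuous_stdGaussCDF
  refine hclosed.csInf_mem ⟨1 / (1 - ε), ?_⟩ ⟨-(1 / ε) - 1, fun x hx => ?_⟩
  · have := one_sub_stdGaussCDF_le (x := 1 / (1 - ε)) (by rw [one_div_pos]; linarith)
    rw [one_div_one_div] at this
    rw [Set.mem_ofPred_eq]
    linarith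
  · by_contra! hlt
    have hpos : 0 < 1 / ε + 1 := by positivity
    have h2 := monotone_stdGaussCDF hlt.le
    rw [show -(1 / ε) - 1 = -(1 / ε + 1) by ring, stdGaussCDF_neg] at h2
    have h3 := one_sub_stdGaussCDF_le hpos
    have h4 : 1 / (1 / ε + 1) < ε := by
      rw [div_lt_iff₀ hpos, mul_add, mul_one_div_cancel h0.ne']
      linarith
    have : ε ≤ stdGaussCDF x := hx
    linarith

/-- The Gaussian distribution function grows at least linearly to the right of a quantile. -/
lemma exists_add_mul_le_stdGaussCDF {ε : ℝ} (h0 : 0 < ε) (h1 : ε < 1) :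
    ∃ d : ℝ, 0 < d ∧ ∀ u, 0 ≤ u → u ≤ 1 → ε + d * u ≤ stdGaussCDF (stdGaussInvCDF ε + u) := by
  set z := stdGaussInvCDF ε
  refine ⟨(√(2 * π))⁻¹ * exp (-(|z| + 1) ^ 2 / 2), by positivity, fun u hu hu1 => ?_⟩
  have h := le_stdGaussCDF_stdGaussInvCDF h0 h1
  have h2 : u * exp (-(|z| + 1) ^ 2 / 2) ≤ ∫ t in z..(z + u), exp (-t ^ 2 / 2) := by
    have : ∫ t in z..(z + u), exp (-(|z| + 1) ^ 2 / 2) = u * exp (-(|z| + 1) ^ 2 / 2) := by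
      simp
    rw [← this]
    refine intervalIntegral.integral_mono_on (by linarith) (by simp)
      integrable_exp_neg_sq_div_two.intervalIntegrable fun t ht => ?_
    have : t ^ 2 ≤ (|z| + 1) ^ 2 := sq_le_sq' (by linarith [neg_abs_le z, ht.1])
      (by linarith [le_abs_self z, ht.2])
    exact exp_le_exp.2 (by linarith)
  have h3 : (√(2 * π))⁻¹ * (u * exp (-(|z| + 1) ^ 2 / 2)) ≤
      stdGaussCDF (z + u) - stdGaussCDF z := by
    rw [stdGaussCDF_sub]
    gcongr
  linarith

/-- Inverting a normal approximation. -/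
lemma exists_le_of_softStep_le {a T : Y → ℝ} (ha : ∀ b, 0 ≤ a b) (ha1 : ∑ b, a b = 1)
    (hT : ∑ b, a b * T b = 0) {V : ℝ} (hV : ∑ b, a b * T b ^ 2 = V) (hV0 : 0 < V)
    {ε : ℝ} (h0 : 0 < ε) (h1 : ε < 1) :
    ∃ K : ℝ, 0 < K ∧ ∀ N : ℕ, 0 < N → ∀ l, 1 - ε ≤ iidSumExp a T N (softStep l) →
      l ≤ √(N * V) * stdGaussInvCDF ε + K := by
  set B := ∑ b, |T b|
  have hB : ∀ b, |T b| ≤ B := fun b =>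
    single_le_sum (f := fun b => |T b|) (fun _ _ => abs_nonneg _) (mem_univ b)
  have hB0 : 0 ≤ B := sum_nonneg fun b _ => abs_nonneg _
  obtain ⟨c, hc, hbe⟩ := iidSumExp.exists_softStep_le ha ha1 hT hV hV0 hB
  obtain ⟨d, hd, hΦ⟩ := exists_add_mul_le_stdGaussCDF h0 h1
  set z := stdGaussInvCDF ε
  set q := (c + 1) / d
  have hq : 0 < q := by positivity
  have hlog : log (1 - ε) ≤ 0 := log_nonpos (by linarith) (by linarith)
  refine ⟨q + (q ^ 2 / V * B - log (1 - ε) + q * |z|), by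
    have : 0 ≤ q ^ 2 / V * B := by positivity
    have : 0 ≤ q * |z| := by positivity
    linarith, fun N hN l hl => ?_⟩
  set r := √(N * V) with hr
  have hr0 : 0 < r := by positivity
  rcases le_or_gt q r with hqr | hqr
  · have hu1 : q / r ≤ 1 := (div_le_one hr0).2 hqr
    have h2 := hΦ (q / r) (by positivity) hu1
    have h3 := hbe N hN l
    have h4 : d * (q / r) = c / r + 1 / r := by
      simp only [q]
      field_simp
    have h5 : 0 < 1 / r := by positivity
    have h6 : stdGaussCDF (l / r) < stdGaussCDF (z + q / r) := by linarith
    have h7 := monotone_stdGaussCDF.reflect_lt h6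
    rw [div_lt_iff₀ hr0, add_mul, div_mul_cancel₀ _ hr0.ne'] at h7
    have : 0 ≤ q ^ 2 / V * B := by positivity
    have : 0 ≤ q * |z| := by positivity
    linarith
  · have h2 : iidSumExp a T N (softStep l) ≤ exp (N * B - l) := by
      rw [← iidSumExp.const ha1 (T := T) N (exp (N * B - l))]
      refine iidSumExp.mono_of_abs_le ha hB N fun s hs => (min_le_right _ _).trans ?_
      exact exp_le_exp.2 (by linarith [le_abs_self s])
    have h3 : log (1 - ε) ≤ N * B - l := by
      rw [← log_exp (N * B - l)]
      exact log_le_log (by linarith) (hl.trans h2)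
    have h4 : (N : ℝ) ≤ q ^ 2 / V := by
      rw [le_div_iff₀ hV0, ← sq_sqrt (show 0 ≤ (N : ℝ) * V by positivity)]
      exact pow_le_pow_left₀ hr0.le hqr.le 2
    have h5 : N * B ≤ q ^ 2 / V * B := by gcongr
    have h6 : r * -z ≤ q * |z| :=
      (mul_le_mul_of_nonneg_left (neg_le_abs z) hr0.le).trans
        (mul_le_mul_of_nonneg_right hqr.le (abs_nonneg z))
    linarith

omit [Fintype X] in
/-- The law of an additive functional of the output of a channel with feedback, when its
one-step law does not depend on the input. -/
lemma sum_prod_causal_eq {a T : Y → ℝ} {V : X → Y → ℝ}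
    (hV : ∀ x (g : ℝ → ℝ), ∑ y, V x y * g (T y) = ∑ y, a y * g (T y)) (N : ℕ)
    (f : (Fin N → Y) → Fin N → X)
    (hf : ∀ y y' n, (∀ k, k < n → y k = y' k) → f y n = f y' n) (G : ℝ → ℝ) :
    ∑ y : Fin N → Y, (∏ n, V (f y n) (y n)) * G (∑ n, T (y n)) = iidSumExp a T N G := by
  induction N generalizing G with
  | zero => simp [iidSumExp]
  | succ N ih =>
    rw [← (Fin.consEquiv fun _ => Y).sum_comp, Fintype.sum_prod_type]
    rcases isEmpty_or_nonempty (Fin (N + 1) → Y) with hE | ⟨⟨y0⟩⟩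
    · have : IsEmpty Y := by
        by_contra h
        rw [not_isEmpty_iff] at h
        exact hE.false fun _ => h.some
      simp [iidSumExp]
    have h0 : ∀ y, f y 0 = f y0 0 := fun y => hf _ _ _ fun k hk => absurd hk (Fin.not_lt_zero k)
    have h1 : ∀ b, ∑ y : Fin N → Y, (∏ n, V (f (Fin.cons b y) n) ((Fin.cons b y : _ → Y) n)) *
        G (∑ n, T ((Fin.cons b y : Fin (N + 1) → Y) n)) =
        V (f y0 0) b * iidSumExp a T N (fun s => G (T b + s)) := fun b => by
      rw [← ih (fun y n => f (Fin.cons b y) n.succ) ?_ fun s => G (T b + s), mul_sum]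
      · refine sum_congr rfl fun y _ => ?_
        rw [Fin.prod_univ_succ, Fin.sum_univ_succ, h0]
        simp only [Fin.cons_zero, Fin.cons_succ]
        ring
      · intro y y' n h
        refine hf _ _ _ fun k hk => ?_
        cases k using Fin.cases with
        | zero => rfl
        | succ k => exact h k (Fin.succ_lt_succ_iff.1 hk)
    refine (sum_congr rfl fun b _ => h1 b).trans ?_
    exact hV (f y0 0) fun t => iidSumExp a T N fun s => G (t + s)

omit [Fintype X] in
/-- The converse bound for feedback codes over a channel dominated by `p`. -/
lemma one_sub_avgErrorProbFb_le {W : X → Y → ℝ} (hW0 : ∀ x y, 0 ≤ W x y) {a T p : Y → ℝ}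
    (ha1 : ∑ y, a y = 1) {c : ℝ}
    (hW : ∀ x (g : ℝ → ℝ), ∑ y, W x y * g (T y) = ∑ y, a y * g (T y))
    (hWp : ∀ x y, W x y ≤ p y)
    (hp : ∀ g : ℝ → ℝ, ∑ y, p y * g (T y) = ∑ y, a y * exp (T y + c) * g (T y))
    {N M : ℕ} (hM : 0 < M) (f : Fin M → (Fin N → Y) → Fin N → X) (φ : (Fin N → Y) → Fin M)
    (hf : Causal f) :
    1 - avgErrorProbFb W f φ ≤ iidSumExp a T N (softStep (log M - N * c)) := by
  classical
  set l := log M - N * c with hl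
  have hM' : (0 : ℝ) < M := by exact_mod_cast hM
  set P : Fin M → (Fin N → Y) → ℝ := fun m y => ∏ n, W (f m y n) (y n) with hP
  have hP0 : ∀ m y, 0 ≤ P m y := fun m y => prod_nonneg fun n _ => hW0 _ _
  have hA : ∀ m G, ∑ y, P m y * G (∑ n, T (y n)) = iidSumExp a T N G := fun m G =>
    sum_prod_causal_eq hW N (f m) (hf m) G
  have hPsum : ∀ m, ∑ y, P m y = 1 := fun m => by
    have := hA m fun _ => 1
    rwa [iidSumExp.const ha1, sum_congr rfl fun y _ => mul_one (P m y)] at this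
  have hcorrect : 1 - avgErrorProbFb W f φ = (M : ℝ)⁻¹ * ∑ y, P (φ y) y := by
    have h1 : ∑ m, ∑ y ∈ univ.filter (fun y => φ y ≠ m), P m y =
        M - ∑ y, P (φ y) y := by
      have h2 : ∀ m, ∑ y ∈ univ.filter (fun y => φ y ≠ m), P m y =
          1 - ∑ y, if φ y = m then P m y else 0 := fun m => by
        rw [← hPsum m, ← sum_filter_add_sum_filter_not univ (fun y => φ y = m) (P m),
          sum_filter (fun y => φ y = m)]
        ring
      simp only [h2, sum_sub_distrib]
      rw [sum_comm]
      simp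
    rw [avgErrorProbFb]
    change 1 - (M : ℝ)⁻¹ * ∑ m, ∑ y ∈ univ.filter (fun y => φ y ≠ m), P m y = _
    rw [h1, mul_sub, inv_mul_cancel₀ hM'.ne']
    ring
  have hB : ∀ G : ℝ → ℝ, ∑ y : Fin N → Y, (∏ n, p (y n)) * G (∑ n, T (y n)) =
      iidSumExp a T N (fun s => exp (s + N * c) * G s) := fun G => by
    rw [← iidSumExp.exp_tilt]
    exact sum_prod_causal_eq (X := Unit) (V := fun _ => p) (fun _ => hp) N
      (fun _ _ => ()) (fun _ _ _ _ => rfl) G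
  have hbound : ∀ y : Fin N → Y, P (φ y) y ≤
      (∑ m, P m y * if l ≤ ∑ n, T (y n) then 1 else 0) +
      (∏ n, p (y n)) * if l ≤ ∑ n, T (y n) then 0 else 1 := fun y => by
    split_ifs
    · simpa using single_le_sum (f := fun m => P m y) (fun m _ => hP0 m y) (mem_univ (φ y))
    · simpa using prod_le_prod (fun n _ => hW0 _ _) fun n _ => hWp _ _
  rw [hcorrect]
  calc _ ≤ (M : ℝ)⁻¹ * (∑ y, ((∑ m, P m y * if l ≤ ∑ n, T (y n) then 1 else 0) +
      (∏ n, p (y n)) * if l ≤ ∑ n, T (y n) then 0 else 1)) := by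
        gcongr with y
        exact hbound y
    _ = iidSumExp a T N (fun s => if l ≤ s then 1 else 0) + (M : ℝ)⁻¹ *
        iidSumExp a T N (fun s => exp (s + N * c) * if l ≤ s then 0 else 1) := by
        rw [sum_add_distrib, sum_comm, hB fun s => if l ≤ s then 0 else 1,
          sum_congr rfl fun m _ => hA m fun s => if l ≤ s then 1 else 0]
        simp only [sum_const, card_univ, Fintype.card_fin, nsmul_eq_mul, mul_add]
        rw [inv_mul_cancel_left₀ hM'.ne']
    _ = iidSumExp a T N (softStep l) := by
        rw [← iidSumExp.const_mul, ← iidSumExp.add]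
        congr 1
        ext s
        have he : (M : ℝ)⁻¹ * exp (s + N * c) = exp (s - l) := by
          rw [hl, ← sub_add, sub_add_eq_add_sub, exp_sub, exp_log hM']
          ring
        rw [softStep]
        split_ifs with hs
        · rw [min_eq_left (one_le_exp (by linarith))]
          ring
        · rw [min_eq_right (exp_le_one_iff.2 (by linarith)), ← he]
          ring

/-- The output distribution induced by the uniform input distribution. -/
noncomputable def unifOutput (W : X → Y → ℝ) (y : Y) : ℝ := (∑ x, W x y) / Fintype.card X

open Classical in
/-- The information density `log (W x y / q y)` of a singular channel with uniform input, which
depends only on the output whenever `W x y > 0`. -/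
noncomputable def outputInfo (W : X → Y → ℝ) (y : Y) : ℝ :=
  log (Fintype.card X / #{x | 0 < W x y})

section Channel

variable {W : X → Y → ℝ}

omit [Fintype Y] in
lemma unifOutput_nonneg (hW0 : ∀ x y, 0 ≤ W x y) (y : Y) : 0 ≤ unifOutput W y :=
  div_nonneg (sum_nonneg fun x _ => hW0 x y) (Nat.cast_nonneg _)

lemma sum_unifOutput [Nonempty X] (hW : IsDMC W) : ∑ y, unifOutput W y = 1 := by
  simp only [unifOutput]
  rw [← sum_div, sum_comm]
  simp [hW.2]

omit [Fintype Y] in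
lemma unifOutput_pos (hW0 : ∀ x y, 0 ≤ W x y) {x : X} {y : Y} (h : 0 < W x y) :
    0 < unifOutput W y := by
  have : Nonempty X := ⟨x⟩
  exact div_pos (sum_pos' (fun x _ => hW0 x y) ⟨x, mem_univ x, h⟩) (by positivity)

omit [Fintype Y] in
lemma Singular.eq_unifOutput_mul_exp (hs : Singular W) (hW0 : ∀ x y, 0 ≤ W x y) {x : X} {y : Y}
    (h : 0 < W x y) : W x y = unifOutput W y * exp (outputInfo W y) := by
  classical
  have hX : Nonempty X := ⟨x⟩
  have hk : 0 < #{x | 0 < W x y} := card_pos.2 ⟨x, by simpa using h⟩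
  have hsum : ∑ z, W z y = #{x | 0 < W x y} * W x y := by
    rw [← nsmul_eq_mul, ← sum_const, sum_filter]
    refine sum_congr rfl fun z _ => ?_
    split_ifs with hz
    · exact hs z x y (mul_pos hz h)
    · exact le_antisymm (not_lt.1 hz) (hW0 z y)
  have hk' : (0 : ℝ) < #{x | 0 < W x y} := by exact_mod_cast hk
  have hX' : (0 : ℝ) < Fintype.card X := by positivity
  rw [unifOutput, outputInfo, hsum]
  rw [show (univ.filter fun x => 0 < W x y) = @filter X (fun x => 0 < W x y)
    (fun _ => Classical.propDecidable _) univ by congr] at *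
  rw [exp_log (by positivity)]
  field_simp

omit [Fintype Y] in
lemma Singular.le_unifOutput_mul_exp (hs : Singular W) (hW0 : ∀ x y, 0 ≤ W x y) (x : X) (y : Y) :
    W x y ≤ unifOutput W y * exp (outputInfo W y) := by
  rcases (hW0 x y).eq_or_lt with h | h
  · rw [← h]
    exact mul_nonneg (unifOutput_nonneg hW0 y) (exp_pos _).le
  · exact (hs.eq_unifOutput_mul_exp hW0 h).le

/-- The law of the information density under a symmetric channel does not depend on the input. -/
lemma GallagerSymmetric.sum_mul_outputInfo_eq (hsym : GallagerSymmetric W) (x x' : X)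
    (g : ℝ → ℝ) :
    ∑ y, W x y * g (outputInfo W y) = ∑ y, W x' y * g (outputInfo W y) := by
  classical
  obtain ⟨cls, hrow, hcol⟩ := hsym
  have hinfo : ∀ y y', cls y = cls y' → outputInfo W y = outputInfo W y' := fun y y' h => by
    have h2 := congrArg (Multiset.countP (fun t : ℝ => 0 < t)) (hcol y y' h)
    rw [Multiset.countP_map, Multiset.countP_map] at h2
    rw [outputInfo, outputInfo, Finset.card, Finset.card, filter_val, filter_val]
    congr 3
  have hfib : ∀ F : Y → ℝ, ∑ y, F y = ∑ l ∈ univ.image cls, ∑ y with cls y = l, F y :=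
    fun F => (sum_fiberwise_of_maps_to (fun y _ => mem_image_of_mem cls (mem_univ y)) F).symm
  rw [hfib, hfib]
  refine sum_congr rfl fun l hl => ?_
  obtain ⟨y₁, -, rfl⟩ := mem_image.1 hl
  have hcls : ∀ z, ∑ y with cls y = cls y₁, W z y * g (outputInfo W y) =
      (∑ y with cls y = cls y₁, W z y) * g (outputInfo W y₁) := fun z => by
    rw [sum_mul]
    refine sum_congr rfl fun y hy => ?_
    rw [hinfo y y₁ (mem_filter.1 hy).2]
  rw [hcls, hcls]
  congr 1
  exact congrArg Multiset.sum (hrow (cls y₁) x x')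

variable [Nonempty X] (hW : IsDMC W) (hsym : GallagerSymmetric W) (hs : Singular W)

include hsym in
lemma sum_unifOutput_mul_exp (x : X) (g : ℝ → ℝ) :
    ∑ y, unifOutput W y * exp (outputInfo W y) * g (outputInfo W y) =
      ∑ y, W x y * exp (outputInfo W y) * g (outputInfo W y) := by
  have h := hsym.sum_mul_outputInfo_eq (g := fun t => exp t * g t)
  simp only [unifOutput, div_mul_eq_mul_div, sum_mul]
  rw [← sum_div, sum_comm]
  simp only [mul_assoc]
  rw [sum_congr rfl fun z _ => h z x, sum_const, card_univ, nsmul_eq_mul]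
  field_simp

omit [Nonempty X] in
include hW hs in
lemma mul_log_div_eq (x : X) (y : Y) {r : ℝ} (hr : 0 < W x y → 0 < r) :
    W x y * log (W x y / r) = W x y * (outputInfo W y + log (unifOutput W y / r)) := by
  rcases (hW.1 x y).eq_or_lt with h | h
  · simp [← h]
  · have hq := unifOutput_pos hW.1 h
    have hr' := hr h
    congr 1
    rw [hs.eq_unifOutput_mul_exp hW.1 h, mul_div_right_comm, log_mul (by positivity)
      (exp_pos _).ne', log_exp, add_comm]

omit [Nonempty X] in
lemma sum_output_eq_one (hW : IsDMC W) {Q : X → ℝ} (hQ : IsProbDist Q) :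
    ∑ y, ∑ z, Q z * W z y = 1 := by
  rw [sum_comm]
  simp [← mul_sum, hW.2, hQ.2]

omit [Nonempty X] in
include hW hsym hs in
lemma mutualInfo_eq_add (x₀ : X) {Q : X → ℝ} (hQ : IsProbDist Q) :
    mutualInfo W Q = ∑ y, W x₀ y * outputInfo W y +
      ∑ y, (∑ z, Q z * W z y) * log (unifOutput W y / ∑ z, Q z * W z y) := by
  have h1 : ∀ x y, Q x * W x y * log (W x y / ∑ z, Q z * W z y) =
      Q x * (W x y * outputInfo W y) +
        Q x * W x y * log (unifOutput W y / ∑ z, Q z * W z y) := fun x y => by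
    rcases (hQ.1 x).eq_or_lt with h | h
    · simp [← h]
    · rw [mul_assoc, mul_log_div_eq hW hs x y fun hxy => sum_pos'
        (fun z _ => mul_nonneg (hQ.1 z) (hW.1 z y)) ⟨x, mem_univ x, mul_pos h hxy⟩]
      ring
  simp only [mutualInfo, h1, sum_add_distrib, ← mul_sum]
  rw [sum_congr rfl fun x _ => by rw [hsym.sum_mul_outputInfo_eq x x₀ fun t => t], ← sum_mul,
    hQ.2, one_mul, sum_comm]
  simp only [sum_mul]

omit [Nonempty X] in
include hW in
lemma output_mul_log_le {Q : X → ℝ} (hQ : IsProbDist Q) (y : Y) :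
    (∑ z, Q z * W z y) * log (unifOutput W y / ∑ z, Q z * W z y) ≤
      unifOutput W y - ∑ z, Q z * W z y ∧
    ((∑ z, Q z * W z y) * log (unifOutput W y / ∑ z, Q z * W z y) =
      unifOutput W y - ∑ z, Q z * W z y → ∑ z, Q z * W z y = unifOutput W y) := by
  have h0 : 0 ≤ ∑ z, Q z * W z y := sum_nonneg fun z _ => mul_nonneg (hQ.1 z) (hW.1 z y)
  have hu := unifOutput_nonneg hW.1 y
  rcases h0.eq_or_lt with h | h
  · rw [← h]
    exact ⟨by simpa using hu, fun h => by simpa using h⟩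
  · obtain ⟨z, -, hz⟩ := (sum_pos_iff_of_nonneg
      fun z _ => mul_nonneg (hQ.1 z) (hW.1 z y)).1 h
    have hWz : 0 < W z y := pos_of_mul_pos_right hz (hQ.1 z)
    have hu' := unifOutput_pos hW.1 hWz
    have hr := div_pos hu' h
    generalize ∑ z, Q z * W z y = r at *
    have e : r * (unifOutput W y / r - 1) = unifOutput W y - r := by field_simp
    rw [← e]
    refine ⟨mul_le_mul_of_nonneg_left (log_le_sub_one_of_pos hr) h.le, fun heq => ?_⟩
    by_contra hne
    have h1 : unifOutput W y / r ≠ 1 := fun h1 => hne ((div_eq_one_iff_eq h.ne').1 h1).symm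
    exact (log_lt_sub_one_of_pos hr h1).ne (mul_left_cancel₀ h.ne' heq)

include hW hsym hs in
lemma mutualInfo_le (x₀ : X) {Q : X → ℝ} (hQ : IsProbDist Q) :
    mutualInfo W Q ≤ ∑ y, W x₀ y * outputInfo W y := by
  rw [mutualInfo_eq_add hW hsym hs x₀ hQ]
  have := sum_le_sum fun y (_ : y ∈ univ) => (output_mul_log_le hW hQ y).1
  rw [sum_sub_distrib, sum_unifOutput hW, sum_output_eq_one hW hQ] at this
  linarith

include hW hsym hs in
lemma output_eq_of_mutualInfo_eq (x₀ : X) {Q : X → ℝ} (hQ : IsProbDist Q)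
    (h : mutualInfo W Q = ∑ y, W x₀ y * outputInfo W y) (y : Y) :
    ∑ z, Q z * W z y = unifOutput W y := by
  rw [mutualInfo_eq_add hW hsym hs x₀ hQ, add_eq_left] at h
  refine (output_mul_log_le hW hQ y).2 ?_
  refine (sum_eq_sum_iff_of_le fun y _ => (output_mul_log_le hW hQ y).1).1 ?_ y (mem_univ y)
  rw [h, sum_sub_distrib, sum_unifOutput hW, sum_output_eq_one hW hQ, sub_self]

lemma isProbDist_uniform : IsProbDist fun _ : X => (Fintype.card X : ℝ)⁻¹ :=
  ⟨fun _ => by positivity, by simp⟩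

include hW hsym hs in
lemma mutualInfo_uniform (x₀ : X) :
    mutualInfo W (fun _ => (Fintype.card X : ℝ)⁻¹) = ∑ y, W x₀ y * outputInfo W y := by
  rw [mutualInfo_eq_add hW hsym hs x₀ isProbDist_uniform, add_eq_left]
  refine sum_eq_zero fun y _ => ?_
  have : ∑ z, (Fintype.card X : ℝ)⁻¹ * W z y = unifOutput W y := by
    rw [← mul_sum, unifOutput, inv_mul_eq_div]
  rw [this]
  rcases eq_or_ne (unifOutput W y) 0 with h | h
  · simp [h]
  · simp [div_self h]

include hW hsym hs in
lemma capacity_eq (x₀ : X) : capacity W = ∑ y, W x₀ y * outputInfo W y := by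
  refine IsGreatest.csSup_eq ⟨⟨_, isProbDist_uniform, (mutualInfo_uniform hW hsym hs x₀).symm⟩, ?_⟩
  rintro _ ⟨Q, hQ, rfl⟩
  exact mutualInfo_le hW hsym hs x₀ hQ

include hW hsym hs in
lemma Vdisp_eq (x₀ : X) {Q : X → ℝ} (hQ : IsProbDist Q) (h : mutualInfo W Q = capacity W) :
    Vdisp W Q = ∑ y, W x₀ y * (outputInfo W y - capacity W) ^ 2 := by
  rw [capacity_eq hW hsym hs x₀] at h
  have hlog : ∀ x y, 0 < W x y → log (W x y / unifOutput W y) = outputInfo W y := fun x y hxy => by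
    rw [hs.eq_unifOutput_mul_exp hW.1 hxy, mul_div_cancel_left₀ _ (unifOutput_pos hW.1 hxy).ne',
      log_exp]
  have hin : ∀ x, ∑ b, W x b * log (W x b / unifOutput W b) = capacity W := fun x => by
    rw [capacity_eq hW hsym hs x]
    refine sum_congr rfl fun b _ => ?_
    rcases (hW.1 x b).eq_or_lt with h | h
    · simp [← h]
    · rw [hlog x b h]
  have hterm : ∀ x y, Q x * W x y * (log (W x y / unifOutput W y) - capacity W) ^ 2 =
      Q x * (W x y * (outputInfo W y - capacity W) ^ 2) := fun x y => by
    rcases (hW.1 x y).eq_or_lt with h | h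
    · simp [← h]
    · rw [hlog x y h, mul_assoc]
  simp only [Vdisp, output_eq_of_mutualInfo_eq hW hsym hs x₀ hQ h, hin, hterm, ← mul_sum]
  rw [sum_congr rfl fun x _ => by
    rw [hsym.sum_mul_outputInfo_eq x x₀ fun t => (t - capacity W) ^ 2], ← sum_mul, hQ.2, one_mul]

include hW hsym hs in
lemma Veps_eq (x₀ : X) (ε : ℝ) :
    Veps W ε = ∑ y, W x₀ y * (outputInfo W y - capacity W) ^ 2 := by
  have : {v | ∃ Q, IsProbDist Q ∧ mutualInfo W Q = capacity W ∧ v = Vdisp W Q} =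
      {∑ y, W x₀ y * (outputInfo W y - capacity W) ^ 2} := by
    ext v
    simp only [Set.mem_ofPred_eq, Set.mem_singleton_iff]
    constructor
    · rintro ⟨Q, hQ, hC, rfl⟩
      exact Vdisp_eq hW hsym hs x₀ hQ hC
    · rintro rfl
      have hC : mutualInfo W (fun _ => (Fintype.card X : ℝ)⁻¹) = capacity W := by
        rw [mutualInfo_uniform hW hsym hs x₀, capacity_eq hW hsym hs x₀]
      exact ⟨_, isProbDist_uniform, hC, (Vdisp_eq hW hsym hs x₀ isProbDist_uniform hC).symm⟩
  rw [Veps, this, csInf_singleton, csSup_singleton, ite_self]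

end Channel

/-- **Theorem 3**: for a symmetric singular DMC with `V_ε(W) > 0`, there is a constant
`K(ε,W) > 0` such that for every blocklength `N ≥ 1`, every feedback code with `M` messages and
average error probability at most `ε` satisfies
`ln M ≤ N·C(W) + √(N·V_ε(W))·Φ⁻¹(ε) + K(ε,W)`. -/
theorem statement4 {X Y : Type} [Fintype X] [Fintype Y] [Nonempty X] [Nonempty Y]
    (W : X → Y → ℝ) (hW : IsDMC W) (hsym : GallagerSymmetric W) (hsing : Singular W)
    (ε : ℝ) (hε0 : 0 < ε) (hε1 : ε < 1) (hV : 0 < Veps W ε) :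
    ∃ K : ℝ, 0 < K ∧ ∀ N : ℕ, 0 < N → ∀ (R : ℝ),
      ∀ (f : Fin (Mof N R) → (Fin N → Y) → Fin N → X) (φ : (Fin N → Y) → Fin (Mof N R)),
        Causal f → avgErrorProbFb W f φ ≤ ε →
          Real.log (Mof N R) ≤
            N * capacity W + Real.sqrt (N * Veps W ε) * stdGaussInvCDF ε + K := by
  obtain ⟨x₀⟩ := ‹Nonempty X›
  have : Nonempty X := ⟨x₀⟩
  have hmean : ∑ y, W x₀ y * (outputInfo W y - capacity W) = 0 := by
    simp only [mul_sub, sum_sub_distrib, ← sum_mul, hW.2, one_mul]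
    rw [← capacity_eq hW hsym hsing x₀, sub_self]
  obtain ⟨K, hK, hmain⟩ := exists_le_of_softStep_le (hW.1 x₀) (hW.2 x₀) hmean
    (Veps_eq hW hsym hsing x₀ ε).symm hV hε0 hε1
  refine ⟨K, hK, fun N hN R f φ hf herr => ?_⟩
  have hM : 0 < Mof N R := Nat.ceil_pos.2 (exp_pos _)
  have hconv := one_sub_avgErrorProbFb_le (c := capacity W) hW.1 (hW.2 x₀)
    (T := fun y => outputInfo W y - capacity W)
    (fun x g => hsym.sum_mul_outputInfo_eq x x₀ fun t => g (t - capacity W))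
    (hsing.le_unifOutput_mul_exp hW.1)
    (fun g => by
      simp only [sub_add_cancel]
      exact sum_unifOutput_mul_exp hsym x₀ fun t => g (t - capacity W))
    hM f φ hf
  have := hmain N hN _ ((sub_le_sub_left herr 1).trans hconv)
  linarith
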